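/- arXiv:2212.11748 — 2 statements merged into one kernel-verified Lean document; each statement's English description precedes it below -/
import Mathlib

section
/- Let T be a nondegenerate tetrahedron. Any v ∈ P₃(T) is uniquely determined by the degrees of freedom: the moments ∫_F v q ds for all q ∈ P₁(F) and all four faces F of T, together with the moments ∫_T v q dx for all q in the bubble space 𝔅₃(T). That is, if all these functionals vanish on v ∈ P₃(T), then v = 0, and the number of these functionals equals dim P₃(T) = 20. -/
open MeasureTheory MvPolynomial
open scoped RealInnerProductSpace

noncomputable section

/-- Euclidean 3-space. -/
abbrev E3 := EuclideanSpace ℝ (Fin 3)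

/-- Evaluate a polynomial in 3 variables at a point of `E3`. -/
def evalP (x : E3) (p : MvPolynomial (Fin 3) ℝ) : ℝ :=
  MvPolynomial.eval (fun j => x j) p

/-- The (closed) facet of the tetrahedron opposite to vertex `i`. -/
def face (a : Fin 4 → E3) (i : Fin 4) : Set E3 :=
  convexHull ℝ (a '' {j | j ≠ i})

/-- The (closed) tetrahedron with vertices `a`. -/
def tetra (a : Fin 4 → E3) : Set E3 :=
  convexHull ℝ (Set.range a)


/-- The standard triangle. -/
def stdTri : Set (ℝ × ℝ) := {z | 0 ≤ z.1 ∧ 0 ≤ z.2 ∧ z.1 + z.2 ≤ 1}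

lemma stdTri_compact : IsCompact stdTri := by
  have hc : IsClosed stdTri := by
    refine (isClosed_le continuous_const continuous_fst).inter
      ((isClosed_le continuous_const continuous_snd).inter
        (isClosed_le (continuous_fst.add continuous_snd) continuous_const))
  refine (isCompact_Icc (a := ((0 : ℝ), (0 : ℝ))) (b := (1, 1))).of_isClosed_subset hc ?_
  rintro ⟨s, t⟩ ⟨h1, h2, h3⟩
  simp only at h1 h2 h3
  exact ⟨⟨h1, h2⟩, ⟨by simp only; linarith, by simp only; linarith⟩⟩

lemma integral_stdTri (g : ℝ × ℝ → ℝ) (hg : Continuous g) :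
    ∫ z in stdTri, g z = ∫ s in (0 : ℝ)..1, ∫ t in (0 : ℝ)..(1 - s), g (s, t) := by
  have hm := stdTri_compact.measurableSet
  have hi : IntegrableOn g stdTri := hg.continuousOn.integrableOn_compact stdTri_compact
  rw [← integral_indicator hm, Measure.volume_eq_prod, integral_prod]
  · rw [intervalIntegral.integral_of_le zero_le_one, ← integral_Icc_eq_integral_Ioc,
      ← integral_indicator measurableSet_Icc]
    congr 1
    ext s
    by_cases hs : s ∈ Set.Icc (0 : ℝ) 1
    · rw [Set.indicator_of_mem hs, intervalIntegral.integral_of_le (by linarith [hs.2]),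
        ← integral_Icc_eq_integral_Ioc, ← integral_indicator measurableSet_Icc]
      congr 1
      ext t
      by_cases ht : t ∈ Set.Icc (0 : ℝ) (1 - s)
      · rw [Set.indicator_of_mem ht, Set.indicator_of_mem]
        exact ⟨hs.1, ht.1, by simp only; linarith [ht.2]⟩
      · rw [Set.indicator_of_notMem ht, Set.indicator_of_notMem]
        rintro ⟨h1, h2, h3⟩
        exact ht ⟨h2, by simp only at h3; linarith⟩
    · rw [Set.indicator_of_notMem hs]
      rw [show (fun t => stdTri.indicator g (s, t)) = fun _ => 0 from ?_]
      · simp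
      · ext t
        rw [Set.indicator_of_notMem]
        rintro ⟨h1, h2, h3⟩
        simp only at h1 h2 h3
        exact hs ⟨h1, by linarith⟩
  · rw [← Measure.volume_eq_prod]
    exact hi.integrable_indicator hm

/-- Affine parametrization of a triangle. -/
def triMap (p q r : E3) (z : ℝ × ℝ) : E3 := (1 - z.1 - z.2) • p + z.1 • q + z.2 • r

lemma triMap_continuous (p q r : E3) : Continuous (triMap p q r) := by
  unfold triMap; fun_prop

lemma triMap_image (p q r : E3) : triMap p q r '' stdTri = convexHull ℝ {p, q, r} := by
  rw [convexHull_insert ⟨q, by simp⟩, convexHull_pair]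
  ext x
  rw [mem_convexJoin]
  constructor
  · rintro ⟨⟨s, t⟩, ⟨h1, h2, h3⟩, rfl⟩
    simp only at h1 h2 h3
    refine ⟨p, rfl, ?_⟩
    rcases eq_or_lt_of_le (add_nonneg h1 h2) with h | h
    · have hs : s = 0 := by linarith
      have ht : t = 0 := by linarith
      subst hs ht
      exact ⟨q, left_mem_segment _ _ _, by simpa [triMap] using left_mem_segment ℝ p q⟩
    · refine ⟨(s / (s + t)) • q + (t / (s + t)) • r,
        ⟨_, _, by positivity, by positivity, by field_simp, rfl⟩,
        ⟨1 - (s + t), s + t, by linarith, h.le, by ring, ?_⟩⟩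
      simp only [triMap, smul_add, smul_smul]
      rw [mul_div_cancel₀ _ h.ne', mul_div_cancel₀ _ h.ne', ← add_assoc, sub_sub]
  · rintro ⟨_, rfl, y, ⟨u, v, hu, hv, huv, rfl⟩, ⟨c, d, hc, hd, hcd, rfl⟩⟩
    refine ⟨(d * u, d * v), ⟨by positivity, by positivity, ?_⟩, ?_⟩
    · simp only; rw [← mul_add, huv]; linarith
    · simp only [triMap, smul_add, smul_smul]
      rw [show 1 - d * u - d * v = c by rw [sub_sub, ← mul_add, huv]; linarith, add_assoc]

lemma face_measure (p q r : E3) (hli : LinearIndependent ℝ ![q - p, r - p]) :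
    ∃ c : NNReal, c ≠ 0 ∧ (μH[2] : Measure E3).restrict (convexHull ℝ {p, q, r}) =
      c • (volume.restrict stdTri).map (triMap p q r) ∧
      MeasurableEmbedding (triMap p q r) := by
  let V : Submodule ℝ E3 := Submodule.span ℝ (Set.range ![q - p, r - p])
  let b : Module.Basis (Fin 2) ℝ V := Module.Basis.span hli
  have hfin : Module.finrank ℝ V = 2 := by
    rw [Module.finrank_eq_card_basis b]; simp
  let L : (ℝ × ℝ) ≃L[ℝ] V :=
    ((LinearEquiv.finTwoArrow ℝ ℝ).symm.trans b.equivFun.symm).toContinuousLinearEquiv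
  have hL : ∀ z, ((L z : V) : E3) = z.1 • (q - p) + z.2 • (r - p) := by
    intro z
    have h0 : ((b 0 : V) : E3) = q - p :=
      congrArg Subtype.val (Module.Basis.span_apply hli 0)
    have h1 : ((b 1 : V) : E3) = r - p :=
      congrArg Subtype.val (Module.Basis.span_apply hli 1)
    rw [← h0, ← h1]
    simp [L, Module.Basis.equivFun_symm_apply, Fin.sum_univ_two]
  let ι : V → E3 := fun v => p + v
  have hι : Isometry ι := (IsometryEquiv.addLeft p).isometry.comp isometry_subtype_coe
  have hcomp : triMap p q r = ι ∘ L := by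
    ext1 z
    simp only [Function.comp, ι, hL, triMap]
    module
  have hιe : MeasurableEmbedding ι := hι.isClosedEmbedding.measurableEmbedding
  have hLe : MeasurableEmbedding L := L.toHomeomorph.measurableEmbedding
  have hemb : MeasurableEmbedding (triMap p q r) := hcomp ▸ hιe.comp hLe
  have h1 : Measure.IsAddHaarMeasure (μH[2] : Measure V) := by
    have := MeasureTheory.isAddHaarMeasure_hausdorffMeasure (E := V)
    rw [hfin] at this
    exact_mod_cast this
  have h2 : Measure.IsAddHaarMeasure ((volume : Measure (ℝ × ℝ)).map L) :=
    L.isAddHaarMeasure_map volume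
  have heq := Measure.isAddLeftInvariant_eq_smul (μH[2] : Measure V)
    ((volume : Measure (ℝ × ℝ)).map L)
  set c := Measure.addHaarScalarFactor (μH[2] : Measure V) ((volume : Measure (ℝ × ℝ)).map L)
  refine ⟨c, (Measure.addHaarScalarFactor_pos_of_isAddHaarMeasure _ _).ne', ?_, hemb⟩
  have h3 := hι.map_hausdorffMeasure (d := 2) (Or.inl (by norm_num))
  rw [heq, Measure.map_smul, Measure.map_map hιe.measurable hLe.measurable, ← hcomp] at h3
  have hsub : triMap p q r '' stdTri ⊆ Set.range ι := by
    rw [hcomp]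
    rintro _ ⟨z, _, rfl⟩
    exact ⟨L z, rfl⟩
  rw [← triMap_image]
  have h4 := congrArg (fun m => Measure.restrict m (triMap p q r '' stdTri)) h3
  simp only [Measure.restrict_smul] at h4
  rw [Measure.restrict_restrict_of_subset hsub] at h4
  rw [← h4, hemb.restrict_map, Set.preimage_image_eq _ hemb.injective]

lemma face_integral (p q r : E3) (hli : LinearIndependent ℝ ![q - p, r - p]) :
    ∃ c : ℝ, c ≠ 0 ∧ ∀ f : E3 → ℝ, Continuous f →
      IntegrableOn f (convexHull ℝ {p, q, r}) μH[2] ∧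
      ∫ x in convexHull ℝ {p, q, r}, f x ∂μH[2] =
        c * ∫ s in (0 : ℝ)..1, ∫ t in (0 : ℝ)..(1 - s), f (triMap p q r (s, t)) := by
  obtain ⟨c, hc, hm, hemb⟩ := face_measure p q r hli
  refine ⟨c, by exact_mod_cast hc, fun f hf => ?_⟩
  have hcf : Continuous (fun z => f (triMap p q r z)) := hf.comp (triMap_continuous p q r)
  rw [IntegrableOn, hm, ← integral_stdTri _ hcf]
  constructor
  · refine Integrable.smul_measure_nnreal ?_
    rw [hemb.integrable_map_iff]
    exact hcf.continuousOn.integrableOn_compact stdTri_compact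
  · rw [integral_smul_nnreal_measure, hemb.integral_map]
    rfl

lemma dblInt (c00 c01 c02 c03 c04 c10 c11 c12 c13 c20 c21 c22 c30 c31 c40 : ℝ)
    (g : ℝ → ℝ → ℝ) (hg : ∀ s t, g s t = c00 + c01 * t + c02 * t ^ 2 + c03 * t ^ 3 + c04 * t ^ 4 +
      c10 * s + c11 * s * t + c12 * s * t ^ 2 + c13 * s * t ^ 3 + c20 * s ^ 2 + c21 * s ^ 2 * t +
      c22 * s ^ 2 * t ^ 2 + c30 * s ^ 3 + c31 * s ^ 3 * t + c40 * s ^ 4) :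
    ∫ s in (0 : ℝ)..1, ∫ t in (0 : ℝ)..(1 - s), g s t =
      c00 / 2 + (c01 + c10) / 6 + (2 * c02 + c11 + 2 * c20) / 24 +
      (6 * c03 + 2 * c12 + 2 * c21 + 6 * c30) / 120 +
      (24 * c04 + 6 * c13 + 4 * c22 + 6 * c31 + 24 * c40) / 720 := by
  have poly : ∀ (d0 d1 d2 d3 d4 d5 b : ℝ),
      ∫ t in (0 : ℝ)..b, (d0 + d1 * t + d2 * t ^ 2 + d3 * t ^ 3 + d4 * t ^ 4 + d5 * t ^ 5) =
      d0 * b + d1 * b ^ 2 / 2 + d2 * b ^ 3 / 3 + d3 * b ^ 4 / 4 + d4 * b ^ 5 / 5 +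
        d5 * b ^ 6 / 6 := by
    intro d0 d1 d2 d3 d4 d5 b
    rw [intervalIntegral.integral_eq_sub_of_hasDerivAt
      (f := fun b => d0 * b + d1 * b ^ 2 / 2 + d2 * b ^ 3 / 3 + d3 * b ^ 4 / 4 + d4 * b ^ 5 / 5 +
        d5 * b ^ 6 / 6)]
    · simp
    · intro x _
      have h := ((((((hasDerivAt_id x).const_mul d0).add
        (((hasDerivAt_pow 2 x).const_mul d1).div_const 2)).add
        (((hasDerivAt_pow 3 x).const_mul d2).div_const 3)).add
        (((hasDerivAt_pow 4 x).const_mul d3).div_const 4)).add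
        (((hasDerivAt_pow 5 x).const_mul d4).div_const 5)).add
        (((hasDerivAt_pow 6 x).const_mul d5).div_const 6)
      refine h.congr_deriv ?_
      simp
      ring
    · apply Continuous.intervalIntegrable
      fun_prop
  have inner : ∀ s : ℝ, ∫ t in (0 : ℝ)..(1 - s), g s t =
      (0 + 1 * c00 / 1 + 1 * c01 / 2 + 1 * c02 / 3 + 1 * c03 / 4 + 1 * c04 / 5)
      + (0 - 1 * c00 / 1 - 2 * c01 / 2 - 3 * c02 / 3 - 4 * c03 / 4 - 5 * c04 / 5 + 1 * c10 / 1 + 1 * c11 / 2 + 1 * c12 / 3 + 1 * c13 / 4) * s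
      + (0 + 1 * c01 / 2 + 3 * c02 / 3 + 6 * c03 / 4 + 10 * c04 / 5 - 1 * c10 / 1 - 2 * c11 / 2 - 3 * c12 / 3 - 4 * c13 / 4 + 1 * c20 / 1 + 1 * c21 / 2 + 1 * c22 / 3) * s ^ 2
      + (0 - 1 * c02 / 3 - 4 * c03 / 4 - 10 * c04 / 5 + 1 * c11 / 2 + 3 * c12 / 3 + 6 * c13 / 4 - 1 * c20 / 1 - 2 * c21 / 2 - 3 * c22 / 3 + 1 * c30 / 1 + 1 * c31 / 2) * s ^ 3
      + (0 + 1 * c03 / 4 + 5 * c04 / 5 - 1 * c12 / 3 - 4 * c13 / 4 + 1 * c21 / 2 + 3 * c22 / 3 - 1 * c30 / 1 - 2 * c31 / 2 + 1 * c40 / 1) * s ^ 4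
      + (0 - 1 * c04 / 5 + 1 * c13 / 4 - 1 * c22 / 3 + 1 * c31 / 2 - 1 * c40 / 1) * s ^ 5 := by
    intro s
    rw [show (fun t => g s t) = fun t => ((c00 + c10 * s + c20 * s ^ 2 + c30 * s ^ 3 + c40 * s ^ 4)
      + (c01 + c11 * s + c21 * s ^ 2 + c31 * s ^ 3) * t + (c02 + c12 * s + c22 * s ^ 2) * t ^ 2
      + (c03 + c13 * s) * t ^ 3 + c04 * t ^ 4 + 0 * t ^ 5) from by
        ext t; rw [hg]; ring]
    rw [poly]
    ring
  simp_rw [inner]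
  rw [poly]
  ring
set_option linter.unusedSimpArgs false

lemma evalP_continuous (p : MvPolynomial (Fin 3) ℝ) : Continuous (fun x : E3 => evalP x p) := by
  unfold evalP
  exact (MvPolynomial.continuous_eval p).comp (by fun_prop)

lemma evalP_mul (x : E3) (p q : MvPolynomial (Fin 3) ℝ) :
    evalP x (p * q) = evalP x p * evalP x q := by simp [evalP]

lemma evalP_combo {ι : Type*} [Fintype ι] (q : MvPolynomial (Fin 3) ℝ) (hq : q.totalDegree ≤ 1)
    (w : ι → ℝ) (hw : ∑ j, w j = 1) (b : ι → E3) :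
    evalP (∑ j, w j • b j) q = ∑ j, w j * evalP (b j) q := by
  unfold evalP
  simp only [MvPolynomial.eval_eq', Finset.mul_sum]
  rw [Finset.sum_comm]
  refine Finset.sum_congr rfl fun n hn => ?_
  have hdeg : n 0 + n 1 + n 2 ≤ 1 := by
    have h := (MvPolynomial.le_totalDegree hn).trans hq
    rw [Finsupp.sum_fintype _ _ (by simp)] at h
    simpa [Fin.sum_univ_three] using h
  have key : ∏ i, ((∑ j, w j • b j : E3) i) ^ n i = ∑ j, w j * ∏ i, (b j i) ^ n i := by
    have hx : ∀ i, (∑ j, w j • b j : E3) i = ∑ j, w j * b j i := by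
      intro i
      simp
    simp only [Fin.prod_univ_three, hx]
    have : (n 0 = 0 ∧ n 1 = 0 ∧ n 2 = 0) ∨ (n 0 = 1 ∧ n 1 = 0 ∧ n 2 = 0) ∨
        (n 0 = 0 ∧ n 1 = 1 ∧ n 2 = 0) ∨ (n 0 = 0 ∧ n 1 = 0 ∧ n 2 = 1) := by omega
    rcases this with ⟨h0, h1, h2⟩ | ⟨h0, h1, h2⟩ | ⟨h0, h1, h2⟩ | ⟨h0, h1, h2⟩ <;>
      simp [h0, h1, h2, hw]
  rw [key, Finset.mul_sum]
  refine Finset.sum_congr rfl fun j _ => by ring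

lemma evalP_triMap (q : MvPolynomial (Fin 3) ℝ) (hq : q.totalDegree ≤ 1) (u v w : E3)
    (z : ℝ × ℝ) : evalP (triMap u v w z) q =
      (1 - z.1 - z.2) * evalP u q + z.1 * evalP v q + z.2 * evalP w q := by
  have h := evalP_combo q hq ![1 - z.1 - z.2, z.1, z.2]
    (by simp [Fin.sum_univ_three]; ring) ![u, v, w]
  simpa [Fin.sum_univ_three, triMap] using h

lemma affPoly (f : E3 →ᵃ[ℝ] ℝ) : ∃ P : MvPolynomial (Fin 3) ℝ, P.totalDegree ≤ 1 ∧
    ∀ x, evalP x P = f x := by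
  refine ⟨C (f 0) + ∑ k, C (f.linear (EuclideanSpace.single k 1)) * X k, ?_, ?_⟩
  · refine (totalDegree_add _ _).trans (max_le (by simp) ?_)
    refine totalDegree_finsetSum_le fun k _ => ?_
    refine (totalDegree_mul _ _).trans ?_
    simp
  · intro x
    have hx : f x = f.linear x + f 0 := by
      have := congrFun f.decomp x
      simpa using this
    have hx2 : x = ∑ k, x k • EuclideanSpace.single k (1 : ℝ) := by
      ext i
      simp [Finset.sum_apply, Pi.single_apply]
    rw [hx]
    conv_rhs => rw [hx2]
    simp [evalP, Fin.sum_univ_three]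
    ring

lemma span_top (a : Fin 4 → E3) (hind : AffineIndependent ℝ a) :
    affineSpan ℝ (Set.range a) = ⊤ := by
  rw [hind.affineSpan_eq_top_iff_card_eq_finrank_add_one]
  simp

lemma exists_bary (a : Fin 4 → E3) (hind : AffineIndependent ℝ a) :
    ∃ l : Fin 4 → MvPolynomial (Fin 3) ℝ, (∀ i, (l i).totalDegree ≤ 1) ∧
      (∀ i j, evalP (a j) (l i) = if i = j then 1 else 0) ∧
      ∀ q : MvPolynomial (Fin 3) ℝ, q.totalDegree ≤ 1 → ∀ x,
        evalP x q = ∑ j, evalP (a j) q * evalP x (l j) := by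
  let B : AffineBasis (Fin 4) ℝ E3 := ⟨a, hind, span_top a hind⟩
  choose l hl1 hl2 using fun i => affPoly (B.coord i)
  refine ⟨l, hl1, ?_, ?_⟩
  · intro i j
    rw [hl2]
    exact B.coord_apply i j
  · intro q hq x
    have h := evalP_combo q hq (fun j => B.coord j x) (B.sum_coord_apply_eq_one x) a
    have h2 : ∑ j, B.coord j x • a j = x := B.linear_combination_coord_eq_self x
    rw [h2] at h
    rw [h]
    exact Finset.sum_congr rfl fun j _ => by rw [hl2]; ring

lemma face_eq (a : Fin 4 → E3) (i j k l : Fin 4) (h : ∀ x, x ≠ i ↔ x = j ∨ x = k ∨ x = l) :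
    face a i = convexHull ℝ {a j, a k, a l} := by
  unfold face
  congr 1
  ext y
  simp only [Set.mem_image, Set.mem_ofPred_eq, h, Set.mem_insert_iff, Set.mem_singleton_iff]
  constructor
  · rintro ⟨x, rfl | rfl | rfl, rfl⟩ <;> simp
  · rintro (rfl | rfl | rfl)
    exacts [⟨j, by simp⟩, ⟨k, by simp⟩, ⟨l, by simp⟩]

lemma face_formula (a : Fin 4 → E3) (hind : AffineIndependent ℝ a) (i j k l : Fin 4)
    (hjk : j ≠ k) (hjl : j ≠ l) (hkl : k ≠ l) (hij : i ≠ j) (hik : i ≠ k) (hil : i ≠ l) :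
    ∃ c : ℝ, c ≠ 0 ∧ ∀ f : E3 → ℝ, Continuous f →
      IntegrableOn f (face a i) μH[2] ∧
      ∫ x in face a i, f x ∂μH[2] =
        c * ∫ s in (0 : ℝ)..1, ∫ t in (0 : ℝ)..(1 - s), f (triMap (a j) (a k) (a l) (s, t)) := by
  rw [face_eq a i j k l (by revert i j k l; decide)]
  apply face_integral
  have h := (affineIndependent_iff_linearIndependent_vsub ℝ a j).1 hind
  have h2 := h.comp ![⟨k, hjk.symm⟩, ⟨l, hjl.symm⟩] (by
    intro x y hxy
    fin_cases x <;> fin_cases y <;> simp_all)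
  have h3 : ((fun i : {x // x ≠ j} => a i -ᵥ a j) ∘ ![⟨k, hjk.symm⟩, ⟨l, hjl.symm⟩]) =
      ![a k - a j, a l - a j] := by
    funext x
    fin_cases x <;> simp
  rw [h3] at h2
  exact h2

lemma face_integrable (a : Fin 4 → E3) (hind : AffineIndependent ℝ a) (i : Fin 4) (f : E3 → ℝ)
    (hf : Continuous f) : IntegrableOn f (face a i) μH[2] := by
  obtain ⟨j, k, l, h1, h2, h3, h4, h5, h6⟩ : ∃ j k l : Fin 4, j ≠ k ∧ j ≠ l ∧ k ≠ l ∧ i ≠ j ∧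
    i ≠ k ∧ i ≠ l := by revert i; decide
  obtain ⟨c, -, h⟩ := face_formula a hind i j k l h1 h2 h3 h4 h5 h6
  exact (h f hf).1

lemma face_moment_self (a : Fin 4 → E3) (hind : AffineIndependent ℝ a) (i : Fin 4)
    (r : MvPolynomial (Fin 3) ℝ) (hr : r.totalDegree ≤ 1)
    (hr2 : ∀ j, j ≠ i → evalP (a j) r = 0) (p : MvPolynomial (Fin 3) ℝ) :
    ∫ x in face a i, evalP x p * evalP x r ∂μH[2] = 0 := by
  obtain ⟨j, k, l, h1, h2, h3, h4, h5, h6⟩ : ∃ j k l : Fin 4, j ≠ k ∧ j ≠ l ∧ k ≠ l ∧ i ≠ j ∧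
    i ≠ k ∧ i ≠ l := by clear hr2; revert i; decide
  obtain ⟨c, -, h⟩ := face_formula a hind i j k l h1 h2 h3 h4 h5 h6
  rw [(h (fun x => evalP x p * evalP x r) ((evalP_continuous p).mul (evalP_continuous r))).2]
  simp [evalP_triMap r hr, hr2 j h4.symm, hr2 k h5.symm, hr2 l h6.symm]

lemma dual_fn (a : Fin 4 → E3) (hind : AffineIndependent ℝ a)
    (L : Fin 4 → MvPolynomial (Fin 3) ℝ) (hL1 : ∀ i, (L i).totalDegree ≤ 1)
    (hL2 : ∀ i j, evalP (a j) (L i) = if i = j then 1 else 0) (m n : Fin 4) (hmn : m ≠ n) :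
    ∃ φ : MvPolynomial (Fin 3) ℝ, φ.totalDegree ≤ 3 ∧
      ∫ x in face a m, evalP x φ * evalP x (L n) ∂μH[2] ≠ 0 ∧
      ∀ i j, i ≠ j → ¬ (i = m ∧ j = n) →
        ∫ x in face a i, evalP x φ * evalP x (L j) ∂μH[2] = 0 := by
  obtain ⟨k, l, hmk, hml, hnk, hnl, hkl, hall⟩ : ∃ k l : Fin 4, m ≠ k ∧ m ≠ l ∧ n ≠ k ∧ n ≠ l ∧
    k ≠ l ∧ ∀ x, x = m ∨ x = n ∨ x = k ∨ x = l := by revert m n; decide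
  have hev : ∀ x : E3, ∀ c : ℝ, evalP x (C c) = c := fun x c => by simp [evalP]
  set φ : MvPolynomial (Fin 3) ℝ := L n * (C (-3) * (L k * L l) + L n * L n +
    C (-6) * (L m * L n) + C 3 * (L m * L m)) with hφ
  have hφe : ∀ x, evalP x φ = evalP x (L n) ^ 3 - 3 * evalP x (L n) * evalP x (L k) * evalP x (L l)
      - 6 * evalP x (L m) * evalP x (L n) ^ 2 + 3 * evalP x (L m) ^ 2 * evalP x (L n) := by
    intro x
    simp only [hφ, evalP, map_mul, map_add, eval_C]
    ring
  have hcont : ∀ j, Continuous fun x => evalP x φ * evalP x (L j) := fun j =>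
    (evalP_continuous φ).mul (evalP_continuous (L j))
  refine ⟨φ, ?_, ?_, ?_⟩
  · have h2 : ∀ i j, (L i * L j).totalDegree ≤ 2 := fun i j =>
      (totalDegree_mul _ _).trans (add_le_add (hL1 i) (hL1 j))
    have h3 : ∀ c i j, (C c * (L i * L j)).totalDegree ≤ 2 := fun c i j =>
      (totalDegree_mul _ _).trans (by simpa using h2 i j)
    refine (totalDegree_mul _ _).trans (add_le_add (b := 1) (d := 2) (hL1 n) ?_)
    refine (totalDegree_add _ _).trans (max_le ?_ (h3 _ _ _))
    refine (totalDegree_add _ _).trans (max_le ?_ (h3 _ _ _))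
    exact (totalDegree_add _ _).trans (max_le (h3 _ _ _) (h2 _ _))
  · obtain ⟨c, hc, h⟩ := face_formula a hind m l n k hnl.symm hkl.symm hnk hml hmn hmk
    rw [(h _ (hcont n)).2]
    refine mul_ne_zero hc ?_
    simp only [hφe, evalP_triMap _ (hL1 _), hL2, hmn, hmk, hml, hnk, hnl, hkl, hmn.symm, hmk.symm,
      hml.symm, hnk.symm, hnl.symm, hkl.symm, if_true, if_false]
    rw [dblInt 0 0 0 0 0 0 0 0 0 0 (-3) 3 0 3 1 _ (by intro s t; ring)]
    norm_num
  · intro i j hij hne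
    rcases hall i with rfl | rfl | rfl | rfl
    · obtain ⟨c, hc, h⟩ := face_formula a hind i l n k hnl.symm hkl.symm hnk hml hmn hmk
      rw [(h _ (hcont j)).2]
      refine mul_eq_zero_of_right _ ?_
      rcases hall j with rfl | rfl | rfl | rfl
      · exact absurd rfl hij
      · exact absurd ⟨rfl, rfl⟩ hne
      · simp only [hφe, evalP_triMap _ (hL1 _), hL2, hmn, hmk, hml, hnk, hnl, hkl, hmn.symm,
          hmk.symm, hml.symm, hnk.symm, hnl.symm, hkl.symm, if_true, if_false]
        rw [dblInt 0 0 0 0 0 0 0 (-3) 3 0 0 3 0 1 0 _ (by intro s t; ring)]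
        norm_num
      · simp only [hφe, evalP_triMap _ (hL1 _), hL2, hmn, hmk, hml, hnk, hnl, hkl, hmn.symm,
          hmk.symm, hml.symm, hnk.symm, hnl.symm, hkl.symm, if_true, if_false]
        rw [dblInt 0 0 0 0 0 0 (-3) 6 (-3) 0 6 (-6) 1 (-4) (-1) _ (by intro s t; ring)]
        norm_num
    · have h := face_moment_self a hind i (L i) (hL1 i)
        (fun j hj => by rw [hL2, if_neg hj.symm])
        ((C (-3) * (L k * L l) + L i * L i + C (-6) * (L m * L i) + C 3 * (L m * L m)) * L j)
      rw [← h]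
      congr 1
      ext x
      simp only [hφ, evalP_mul]
      ring
    · obtain ⟨c, hc, h⟩ := face_formula a hind i l n m hnl.symm hml.symm hmn.symm hkl hnk.symm
        hmk.symm
      rw [(h _ (hcont j)).2]
      refine mul_eq_zero_of_right _ ?_
      rcases hall j with rfl | rfl | rfl | rfl
      · simp only [hφe, evalP_triMap _ (hL1 _), hL2, hmn, hmk, hml, hnk, hnl, hkl, hmn.symm,
          hmk.symm, hml.symm, hnk.symm, hnl.symm, hkl.symm, if_true, if_false]
        rw [dblInt 0 0 0 0 0 0 0 0 3 0 0 (-6) 0 1 0 _ (by intro s t; ring)]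
        norm_num
      · simp only [hφe, evalP_triMap _ (hL1 _), hL2, hmn, hmk, hml, hnk, hnl, hkl, hmn.symm,
          hmk.symm, hml.symm, hnk.symm, hnl.symm, hkl.symm, if_true, if_false]
        rw [dblInt 0 0 0 0 0 0 0 0 0 0 0 3 0 (-6) 1 _ (by intro s t; ring)]
        norm_num
      · exact absurd rfl hij
      · simp only [hφe, evalP_triMap _ (hL1 _), hL2, hmn, hmk, hml, hnk, hnl, hkl, hmn.symm,
          hmk.symm, hml.symm, hnk.symm, hnl.symm, hkl.symm, if_true, if_false]
        rw [dblInt 0 0 0 0 0 0 0 3 (-3) 0 (-6) 3 1 5 (-1) _ (by intro s t; ring)]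
        norm_num
    · obtain ⟨c, hc, h⟩ := face_formula a hind i k n m hnk.symm hmk.symm hmn.symm hkl.symm hnl.symm
        hml.symm
      rw [(h _ (hcont j)).2]
      refine mul_eq_zero_of_right _ ?_
      rcases hall j with rfl | rfl | rfl | rfl
      · simp only [hφe, evalP_triMap _ (hL1 _), hL2, hmn, hmk, hml, hnk, hnl, hkl, hmn.symm,
          hmk.symm, hml.symm, hnk.symm, hnl.symm, hkl.symm, if_true, if_false]
        rw [dblInt 0 0 0 0 0 0 0 0 3 0 0 (-6) 0 1 0 _ (by intro s t; ring)]
        norm_num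
      · simp only [hφe, evalP_triMap _ (hL1 _), hL2, hmn, hmk, hml, hnk, hnl, hkl, hmn.symm,
          hmk.symm, hml.symm, hnk.symm, hnl.symm, hkl.symm, if_true, if_false]
        rw [dblInt 0 0 0 0 0 0 0 0 0 0 0 3 0 (-6) 1 _ (by intro s t; ring)]
        norm_num
      · simp only [hφe, evalP_triMap _ (hL1 _), hL2, hmn, hmk, hml, hnk, hnl, hkl, hmn.symm,
          hmk.symm, hml.symm, hnk.symm, hnl.symm, hkl.symm, if_true, if_false]
        rw [dblInt 0 0 0 0 0 0 0 3 (-3) 0 (-6) 3 1 5 (-1) _ (by intro s t; ring)]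
        norm_num
      · exact absurd rfl hij

lemma zero_of_sq_integral (a : Fin 4 → E3) (hind : AffineIndependent ℝ a)
    (p : MvPolynomial (Fin 3) ℝ) (h : ∫ x in tetra a, evalP x p * evalP x p = 0) : p = 0 := by
  have hcomp : IsCompact (tetra a) := (Set.finite_range a).isCompact_convexHull ℝ
  have hcont : Continuous fun x : E3 => evalP x p * evalP x p :=
    (evalP_continuous p).mul (evalP_continuous p)
  rw [setIntegral_eq_zero_iff_of_nonneg_ae (Filter.Eventually.of_forall fun x => mul_self_nonneg _)
    (hcont.continuousOn.integrableOn_compact hcomp)] at h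
  have hint : (interior (tetra a)).Nonempty :=
    interior_convexHull_nonempty_iff_affineSpan_eq_top.2 (span_top a hind)
  have h0 : Set.EqOn (fun x : E3 => evalP x p * evalP x p) 0 (interior (tetra a)) :=
    Measure.eqOn_open_of_ae_eq (ae_restrict_of_ae_restrict_of_subset interior_subset h)
      isOpen_interior hcont.continuousOn continuousOn_const
  obtain ⟨x0, hx0⟩ := hint
  let e := (EuclideanSpace.equiv (Fin 3) ℝ)
  have hopen : IsOpen (e.symm ⁻¹' interior (tetra a)) :=
    isOpen_interior.preimage e.symm.continuous
  obtain ⟨ε, hε, hball⟩ := Metric.isOpen_iff.1 hopen (e x0) (by simpa using hx0)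
  refine MvPolynomial.funext_set (fun i => Metric.ball (e x0 i) ε)
    (fun i => ?_) fun y hy => ?_
  · rw [Real.ball_eq_Ioo]
    exact Set.Ioo_infinite (by linarith)
  · rw [← ball_pi _ hε] at hy
    have := h0 (hball hy)
    have h2 : evalP (e.symm y) p = 0 := mul_self_eq_zero.1 this
    rw [map_zero]
    exact h2

lemma finrank_P3 : Module.Finite ℝ (restrictTotalDegree (Fin 3) ℝ 3) ∧
    Module.finrank ℝ (restrictTotalDegree (Fin 3) ℝ 3) = 20 := by
  let b := basisRestrictSupport ℝ {n : Fin 3 →₀ ℕ | (n.sum fun _ e => e) ≤ 3}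
  have hs : ∀ n : Fin 3 →₀ ℕ, (n.sum fun _ e => e) = n 0 + n 1 + n 2 := fun n => by
    rw [Finsupp.sum_fintype _ _ (by simp), Fin.sum_univ_three]
  let e : {n : Fin 3 →₀ ℕ | (n.sum fun _ e => e) ≤ 3} ≃
      {f : Fin 3 → Fin 4 // (f 0 : ℕ) + f 1 + f 2 ≤ 3} :=
    { toFun := fun n => ⟨fun i => ⟨n.1 i, by
          have h := n.2
          rw [Set.mem_ofPred_eq, hs] at h
          fin_cases i <;> simp <;> omega⟩, by
          have h := n.2
          rw [Set.mem_ofPred_eq, hs] at h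
          exact h⟩
      invFun := fun f => ⟨Finsupp.equivFunOnFinite.symm (fun i => (f.1 i : ℕ)), by
          rw [Set.mem_ofPred_eq, hs]
          exact f.2⟩
      left_inv := fun n => by ext i; simp
      right_inv := fun f => by ext i; simp }
  let b' := b.reindex e
  refine ⟨Module.Finite.of_basis b', ?_⟩
  have := Module.finrank_eq_card_basis b'
  refine this.trans ?_
  decide

/-- Facet moment of `p` against the barycentric coordinates. -/
def momMap (a : Fin 4 → E3) (hind : AffineIndependent ℝ a)
    (L : Fin 4 → MvPolynomial (Fin 3) ℝ) :
    restrictTotalDegree (Fin 3) ℝ 3 →ₗ[ℝ] ({x : Fin 4 × Fin 4 // x.1 ≠ x.2} → ℝ) where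
  toFun p x := ∫ y in face a x.1.1, evalP y p.1 * evalP y (L x.1.2) ∂μH[2]
  map_add' p q := by
    ext x
    have hI : ∀ r : MvPolynomial (Fin 3) ℝ, IntegrableOn
        (fun y => evalP y r * evalP y (L x.1.2)) (face a x.1.1) μH[2] := fun r =>
      face_integrable a hind _ _ ((evalP_continuous r).mul (evalP_continuous _))
    rw [Pi.add_apply, ← integral_add (hI p.1) (hI q.1)]
    congr 1
    ext y
    simp [evalP, add_mul]
  map_smul' c p := by
    ext x
    rw [Pi.smul_apply, RingHom.id_apply, smul_eq_mul, ← integral_const_mul]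
    congr 1
    ext y
    simp [evalP, mul_assoc]

lemma bubble_iff (a : Fin 4 → E3) (hind : AffineIndependent ℝ a)
    (L : Fin 4 → MvPolynomial (Fin 3) ℝ) (hL1 : ∀ i, (L i).totalDegree ≤ 1)
    (hL2 : ∀ i j, evalP (a j) (L i) = if i = j then 1 else 0)
    (hL3 : ∀ q : MvPolynomial (Fin 3) ℝ, q.totalDegree ≤ 1 → ∀ x,
        evalP x q = ∑ j, evalP (a j) q * evalP x (L j)) (p : MvPolynomial (Fin 3) ℝ) :
    (∀ (i : Fin 4) (q : MvPolynomial (Fin 3) ℝ), q.totalDegree ≤ 1 →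
        ∫ x in face a i, evalP x p * evalP x q ∂(μH[2]) = 0) ↔
      ∀ i j, i ≠ j → ∫ x in face a i, evalP x p * evalP x (L j) ∂(μH[2]) = 0 := by
  refine ⟨fun h i j _ => h i _ (hL1 j), fun h i q hq => ?_⟩
  have h1 : (fun x => evalP x p * evalP x q) =
      fun x => ∑ j, evalP (a j) q * (evalP x p * evalP x (L j)) := by
    ext x
    rw [hL3 q hq x, Finset.mul_sum]
    exact Finset.sum_congr rfl fun j _ => by ring
  rw [h1, integral_finsetSum]
  · refine Finset.sum_eq_zero fun j _ => ?_
    rw [integral_const_mul]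
    by_cases hij : i = j
    · subst hij
      rw [face_moment_self a hind i (L i) (hL1 i) (fun j hj => by rw [hL2, if_neg hj.symm]),
        mul_zero]
    · rw [h i j hij, mul_zero]
  · intro j _
    exact face_integrable a hind i _ (continuous_const.mul
      ((evalP_continuous p).mul (evalP_continuous _)))

theorem stmt8 (a : Fin 4 → E3) (hind : AffineIndependent ℝ a) :
    (∀ p : MvPolynomial (Fin 3) ℝ, p.totalDegree ≤ 3 →
      (∀ (i : Fin 4) (q : MvPolynomial (Fin 3) ℝ), q.totalDegree ≤ 1 →
        ∫ x in face a i, evalP x p * evalP x q ∂(μH[2]) = 0) →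
      (∀ b : MvPolynomial (Fin 3) ℝ, b.totalDegree ≤ 3 →
        (∀ (i : Fin 4) (q : MvPolynomial (Fin 3) ℝ), q.totalDegree ≤ 1 →
          ∫ x in face a i, evalP x b * evalP x q ∂(μH[2]) = 0) →
        ∫ x in tetra a, evalP x p * evalP x b = 0) →
      p = 0) ∧
    4 * 3 + Set.finrank ℝ {b : MvPolynomial (Fin 3) ℝ | b.totalDegree ≤ 3 ∧
      ∀ (i : Fin 4) (q : MvPolynomial (Fin 3) ℝ), q.totalDegree ≤ 1 →
        ∫ x in face a i, evalP x b * evalP x q ∂(μH[2]) = 0} = 20 := by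
  refine ⟨fun p hp hf hb => zero_of_sq_integral a hind p (hb p hp hf), ?_⟩
  obtain ⟨L, hL1, hL2, hL3⟩ := exists_bary a hind
  obtain ⟨hfin, hrank⟩ := finrank_P3
  have hset : {b : MvPolynomial (Fin 3) ℝ | b.totalDegree ≤ 3 ∧
      ∀ (i : Fin 4) (q : MvPolynomial (Fin 3) ℝ), q.totalDegree ≤ 1 →
        ∫ x in face a i, evalP x b * evalP x q ∂(μH[2]) = 0} =
      (((LinearMap.ker (momMap a hind L)).map (Submodule.subtype _) :
        Submodule ℝ (MvPolynomial (Fin 3) ℝ)) : Set (MvPolynomial (Fin 3) ℝ)) := by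
    ext p
    rw [Set.mem_ofPred_eq, bubble_iff a hind L hL1 hL2 hL3, SetLike.mem_coe, Submodule.mem_map]
    constructor
    · rintro ⟨h1, h2⟩
      refine ⟨⟨p, (mem_restrictTotalDegree _ _ _).2 h1⟩, ?_, rfl⟩
      rw [LinearMap.mem_ker]
      ext x
      exact h2 _ _ x.2
    · rintro ⟨⟨y, hy⟩, h1, rfl⟩
      refine ⟨(mem_restrictTotalDegree _ _ _).1 hy, fun i j hij => ?_⟩
      rw [LinearMap.mem_ker] at h1
      exact congrFun h1 ⟨(i, j), hij⟩
  rw [hset, Set.finrank, Submodule.span_eq, Submodule.finrank_map_subtype_eq]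
  have hrange : LinearMap.range (momMap a hind L) = ⊤ := by
    rw [eq_top_iff, ← (Pi.basisFun ℝ {x : Fin 4 × Fin 4 // x.1 ≠ x.2}).span_eq, Submodule.span_le]
    rintro _ ⟨⟨⟨m, n⟩, hmn⟩, rfl⟩
    obtain ⟨φ, hφ1, hφ2, hφ3⟩ := dual_fn a hind L hL1 hL2 m n hmn
    refine ⟨(∫ x in face a m, evalP x φ * evalP x (L n) ∂μH[2])⁻¹ •
      ⟨φ, (mem_restrictTotalDegree _ _ _).2 hφ1⟩, ?_⟩
    rw [map_smul]
    ext ⟨⟨i, j⟩, hij⟩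
    rw [Pi.smul_apply, smul_eq_mul, Pi.basisFun_apply]
    by_cases h : i = m ∧ j = n
    · obtain ⟨rfl, rfl⟩ := h
      rw [Pi.single_eq_same]
      exact inv_mul_cancel₀ hφ2
    · rw [Pi.single_eq_of_ne]
      · exact mul_eq_zero_of_right _ (hφ3 i j hij h)
      · intro h'
        simp only [Subtype.mk.injEq, Prod.mk.injEq] at h'
        exact h h'
  have hrn := LinearMap.finrank_range_add_finrank_ker (momMap a hind L)
  rw [hrange, finrank_top, Module.finrank_fintype_fun_eq_card, hrank] at hrn
  have hcard : Fintype.card {x : Fin 4 × Fin 4 // x.1 ≠ x.2} = 12 := by decide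
  rw [hcard] at hrn
  exact hrn
end
end

section
/- On a nondegenerate tetrahedron T, the quadratic polynomial 𝔟₂ = 2 − 4(λ₁² + λ₂² + λ₃² + λ₄²) satisfies ∫_F 𝔟₂ q ds = 0 for every face F of T and every q ∈ P₁(F); moreover the space { v ∈ P₂(T) : ∫_F v q ds = 0 for all q ∈ P₁(F), all faces F } is one-dimensional, spanned by 𝔟₂. -/
open MeasureTheory MvPolynomial
open scoped RealInnerProductSpace

noncomputable section

def Tri : Set (ℝ × ℝ) := {p | 0 ≤ p.1 ∧ 0 ≤ p.2 ∧ p.1 + p.2 ≤ 1}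

def phi (b0 b1 b2 : E3) (p : ℝ × ℝ) : E3 := (1 - p.1 - p.2) • b0 + p.1 • b1 + p.2 • b2

lemma hull_eq (b0 b1 b2 : E3) : convexHull ℝ {b0, b1, b2} = phi b0 b1 b2 '' Tri := by
  rw [convexHull_insert (by simp), convexHull_pair]
  ext x
  simp only [convexJoin, Set.mem_iUnion, Set.mem_singleton_iff, exists_prop, exists_eq_left,
    Set.mem_image, segment_eq_image]
  constructor
  · rintro ⟨y, ⟨t, ⟨ht0, ht1⟩, rfl⟩, s, ⟨hs0, hs1⟩, rfl⟩
    refine ⟨(s * (1 - t), s * t), ⟨by simp; nlinarith, by simp; positivity, by simp; nlinarith⟩, ?_⟩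
    simp only [phi]
    module
  · rintro ⟨⟨p, q⟩, ⟨h0, h1, h2⟩, rfl⟩
    simp only at h0 h1 h2
    by_cases h : p + q = 0
    · have hp : p = 0 := by linarith
      have hq : q = 0 := by linarith
      subst hp hq
      refine ⟨b1, ⟨0, by simp, by simp⟩, 0, by simp, by simp [phi]⟩
    · have hpos : 0 < p + q := lt_of_le_of_ne (by linarith) (Ne.symm h)
      refine ⟨_, ⟨q / (p + q), ⟨by positivity, by rw [div_le_one hpos]; linarith⟩, rfl⟩,
        p + q, ⟨by linarith, h2⟩, ?_⟩
      simp only [phi, smul_add, smul_smul]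
      have e1 : (p + q) * (1 - q / (p + q)) = p := by field_simp; ring
      have e2 : (p + q) * (q / (p + q)) = q := by field_simp
      rw [e1, e2]
      module

lemma face_int (b0 b1 b2 : E3) (hli : LinearIndependent ℝ ![b1 - b0, b2 - b0]) :
    ∃ K : ℝ, K ≠ 0 ∧ ∀ f : E3 → ℝ, ∫ x in convexHull ℝ {b0, b1, b2}, f x ∂(μH[2])
      = K * ∫ p in Tri, f (phi b0 b1 b2 p) := by
  let L : (ℝ × ℝ) →ₗ[ℝ] E3 :=
    (LinearMap.toSpanSingleton ℝ E3 (b1 - b0)).coprod (LinearMap.toSpanSingleton ℝ E3 (b2 - b0))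
  have hL : ∀ p, L p = p.1 • (b1 - b0) + p.2 • (b2 - b0) := by intro p; simp [L]
  have hinj : Function.Injective L := by
    rw [← LinearMap.ker_eq_bot, LinearMap.ker_eq_bot']
    rintro ⟨s, t⟩ h
    rw [hL] at h
    have := (LinearIndependent.pair_iff.mp hli) s t h
    simp [this.1, this.2]
  let e0 := LinearEquiv.ofInjective L hinj
  let W := LinearMap.range L
  let e : (ℝ × ℝ) ≃L[ℝ] W := e0.toContinuousLinearEquiv
  have hfin : Module.finrank ℝ W = 2 := by
    rw [← e0.finrank_eq]; simp
  let ν : Measure W := μH[2]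
  have hν : ν.IsAddHaarMeasure := by
    have := isAddHaarMeasure_hausdorffMeasure (E := W)
    rw [hfin] at this
    exact_mod_cast this
  let m : Measure W := Measure.map e volume
  have hm : m.IsAddHaarMeasure := e.isAddHaarMeasure_map volume
  have hc := Measure.isAddLeftInvariant_eq_smul ν m
  have hc0 : Measure.addHaarScalarFactor ν m ≠ 0 := (Measure.addHaarScalarFactor_pos_of_isAddHaarMeasure ν m).ne'
  set c := Measure.addHaarScalarFactor ν m
  let ι : W → E3 := fun x => b0 + x
  have hι : Isometry ι := by
    intro x y
    simp only [ι, edist_add_left]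
    rfl
  have hmap := hι.map_hausdorffMeasure (d := 2) (Or.inl (by norm_num))
  have hphi : ∀ p, ι (e p) = phi b0 b1 b2 p := by
    intro p
    have : ((e p : W) : E3) = L p := rfl
    simp only [ι, this, hL, phi]
    module
  have hsub : convexHull ℝ {b0, b1, b2} ⊆ Set.range ι := by
    rw [hull_eq]
    rintro _ ⟨p, -, rfl⟩
    exact ⟨e p, hphi p⟩
  have hιc : Topology.IsClosedEmbedding ι := hι.isClosedEmbedding
  have hpre : (ι ⁻¹' convexHull ℝ {b0, b1, b2}) = e '' Tri := by
    rw [hull_eq]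
    ext x
    constructor
    · rintro ⟨p, hp, h⟩
      exact ⟨p, hp, hι.injective (by rw [hphi, h])⟩
    · rintro ⟨p, hp, rfl⟩
      exact ⟨p, hp, (hphi p).symm⟩
  refine ⟨c, by exact_mod_cast hc0, fun f => ?_⟩
  rw [← Measure.restrict_restrict_of_subset hsub, ← hmap,
    hιc.measurableEmbedding.setIntegral_map, hpre]
  change ∫ x in e '' Tri, f (ι x) ∂ν = _
  have he : MeasurableEmbedding e := e.toHomeomorph.measurableEmbedding
  rw [hc, Measure.restrict_smul, integral_smul_nnreal_measure, he.setIntegral_map,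
    Set.preimage_image_eq _ e.injective]
  simp only [hphi]
  rfl

lemma tri_meas : IsCompact Tri := by
  have : IsClosed Tri := by
    have : Tri = {p : ℝ × ℝ | 0 ≤ p.1} ∩ ({p | 0 ≤ p.2} ∩ {p | p.1 + p.2 ≤ 1}) := by
      ext; simp [Tri]
    rw [this]
    exact (isClosed_le (by fun_prop) (by fun_prop)).inter
      ((isClosed_le (by fun_prop) (by fun_prop)).inter (isClosed_le (by fun_prop) (by fun_prop)))
  refine (isCompact_Icc (a := ((0:ℝ),(0:ℝ))) (b := (1,1))).of_isClosed_subset this ?_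
  rintro ⟨x, y⟩ ⟨h1, h2, h3⟩
  simp only at h1 h2 h3
  exact ⟨⟨h1, h2⟩, ⟨by simp only; linarith, by simp only; linarith⟩⟩

lemma tri_fubini (f : ℝ × ℝ → ℝ) (hf : Continuous f) :
    ∫ p in Tri, f p = ∫ s in (0:ℝ)..1, ∫ t in (0:ℝ)..(1-s), f (s,t) := by
  have hm := tri_meas.measurableSet
  rw [← integral_indicator hm, Measure.volume_eq_prod, integral_prod]
  · rw [intervalIntegral.integral_of_le zero_le_one, ← integral_Icc_eq_integral_Ioc,
      ← integral_indicator measurableSet_Icc]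
    congr 1
    ext s
    by_cases hs : s ∈ Set.Icc (0:ℝ) 1
    · rw [Set.indicator_of_mem hs, intervalIntegral.integral_of_le (by linarith [hs.2]),
        ← integral_Icc_eq_integral_Ioc, ← integral_indicator measurableSet_Icc]
      congr 1
      ext t
      have : (s,t) ∈ Tri ↔ t ∈ Set.Icc 0 (1-s) := by
        simp only [Tri, Set.mem_ofPred_eq, Set.mem_Icc]
        constructor
        · rintro ⟨a, b, c⟩; exact ⟨b, by linarith⟩
        · rintro ⟨a, b⟩; exact ⟨hs.1, a, by linarith⟩
      by_cases h : t ∈ Set.Icc 0 (1-s)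
      · rw [Set.indicator_of_mem h, Set.indicator_of_mem (this.2 h)]
      · rw [Set.indicator_of_notMem h, Set.indicator_of_notMem (fun h' => h (this.1 h'))]
    · rw [Set.indicator_of_notMem hs]
      have : ∀ t, Tri.indicator f (s,t) = 0 := by
        intro t
        apply Set.indicator_of_notMem
        rintro ⟨h1, h2, h3⟩
        exact hs ⟨h1, by simp only at h2 h3; linarith⟩
      simp [this]
  · rw [← Measure.volume_eq_prod, integrable_indicator_iff hm]
    exact hf.continuousOn.integrableOn_compact tri_meas

lemma cubic_int (x c0 c1 c2 c3 : ℝ) : ∫ t in (0:ℝ)..x, (c0 + c1 * t + c2 * t^2 + c3 * t^3)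
    = c0 * x + c1 * x^2/2 + c2 * x^3/3 + c3*x^4/4 := by
  have h := intervalIntegral.integral_eq_sub_of_hasDerivAt (a := 0) (b := x)
    (f := fun t => c0 * t + c1 * t^2/2 + c2 * t^3/3 + c3*t^4/4)
    (f' := fun t => c0 + c1 * t + c2 * t^2 + c3 * t^3) (fun t _ => by
      have h1 := ((hasDerivAt_id t).const_mul c0).add ((((hasDerivAt_pow 2 t).const_mul c1).div_const 2).add
        ((((hasDerivAt_pow 3 t).const_mul c2).div_const 3).add (((hasDerivAt_pow 4 t).const_mul c3).div_const 4)))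
      convert h1 using 1
      · ext y; simp; ring
      · simp; ring) (Continuous.intervalIntegrable (by fun_prop) _ _)
  rw [h]; ring

lemma quartic_int (c0 c1 c2 c3 c4 : ℝ) : ∫ t in (0:ℝ)..1, (c0 + c1 * t + c2 * t^2 + c3 * t^3 + c4 * t^4)
    = c0 + c1/2 + c2/3 + c3/4 + c4/5 := by
  have h := intervalIntegral.integral_eq_sub_of_hasDerivAt (a := 0) (b := 1)
    (f := fun t : ℝ => c0 * t + c1 * t^2/2 + c2 * t^3/3 + c3*t^4/4 + c4*t^5/5)
    (f' := fun t => c0 + c1 * t + c2 * t^2 + c3 * t^3 + c4 * t^4) (fun t _ => by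
      have h1 := ((hasDerivAt_id t).const_mul c0).add ((((hasDerivAt_pow 2 t).const_mul c1).div_const 2).add
        ((((hasDerivAt_pow 3 t).const_mul c2).div_const 3).add ((((hasDerivAt_pow 4 t).const_mul c3).div_const 4).add
         (((hasDerivAt_pow 5 t).const_mul c4).div_const 5))))
      convert h1 using 1
      · ext y; simp; ring
      · simp; ring) (Continuous.intervalIntegrable (by fun_prop) _ _)
  rw [h]; ring

/-- The integral over `t ∈ [0, 1 - s]` of the integrand in `tri_int`. -/
def triAux (A B C D E G k0 k1 k2 s : ℝ) : ℝ :=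
  ((A*(1-s)^2+B*s^2+D*s*(1-s)) * (k0*(1-s)+k1*s)) * (1-s)
  + ((A*(1-s)^2+B*s^2+D*s*(1-s))*(k2-k0) + (-2*A*(1-s)-D*s+E*(1-s)+G*s)*(k0*(1-s)+k1*s)) * (1-s)^2/2
  + ((-2*A*(1-s)-D*s+E*(1-s)+G*s)*(k2-k0) + (A+C-E)*(k0*(1-s)+k1*s)) * (1-s)^3/3
  + ((A+C-E)*(k2-k0)) * (1-s)^4/4

lemma quartic_interp (g : ℝ → ℝ)
    (h : ∀ s, g s = g 0 + (8*(g 1-g (-1))-(g 2-g (-2)))/12 * s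
      + (16*(g 1+g (-1)) - (g 2+g (-2)) - 30*g 0)/24 * s^2
      + ((g 2-g (-2))-2*(g 1-g (-1)))/12 * s^3
      + ((g 2+g (-2))-4*(g 1+g (-1))+6*g 0)/24 * s^4) :
    ∫ s in (0:ℝ)..1, g s = g 0 + (8*(g 1-g (-1))-(g 2-g (-2)))/12 / 2
      + (16*(g 1+g (-1)) - (g 2+g (-2)) - 30*g 0)/24 / 3
      + ((g 2-g (-2))-2*(g 1-g (-1)))/12 / 4
      + ((g 2+g (-2))-4*(g 1+g (-1))+6*g 0)/24 / 5 := by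
  rw [← quartic_int]
  exact intervalIntegral.integral_congr (fun s _ => h s)

lemma tri_int (A B C D E G k0 k1 k2 : ℝ) :
    ∫ p in Tri, (A * (1-p.1-p.2)^2 + B * p.1^2 + C * p.2^2 + D * ((1-p.1-p.2)*p.1)
      + E * ((1-p.1-p.2)*p.2) + G * (p.1*p.2)) * (k0 * (1-p.1-p.2) + k1 * p.1 + k2 * p.2)
    = (k0 * (6*A+2*B+2*C+2*D+2*E+G) + k1 * (2*A+6*B+2*C+2*D+E+2*G)
      + k2 * (2*A+2*B+6*C+D+2*E+2*G)) / 120 := by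
  rw [tri_fubini _ (by fun_prop)]
  have inner : ∀ s : ℝ, (∫ t in (0:ℝ)..(1-s), (A * (1-s-t)^2 + B * s^2 + C * t^2 + D * ((1-s-t)*s)
      + E * ((1-s-t)*t) + G * (s*t)) * (k0 * (1-s-t) + k1 * s + k2 * t)) =
      triAux A B C D E G k0 k1 k2 s := by
    intro s
    rw [triAux, ← cubic_int]
    congr 1
    ext t
    ring
  simp only [inner]
  rw [quartic_interp (triAux A B C D E G k0 k1 k2) (fun s => by simp only [triAux]; ring)]
  simp only [triAux]
  ring

/-- The point with barycentric coordinates `t`. -/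
def pt (a : Fin 4 → E3) (t : Fin 4 → ℝ) : E3 := ∑ i, t i • a i

lemma pt_coord (a : Fin 4 → E3) (t : Fin 4 → ℝ) (j : Fin 3) : pt a t j = ∑ i, a i j * t i := by
  simp [pt, mul_comm]

lemma pt_surj (a : Fin 4 → E3) (hind : AffineIndependent ℝ a) (x : E3) :
    ∃ t : Fin 4 → ℝ, ∑ i, t i = 1 ∧ x = pt a t := by
  have htop : affineSpan ℝ (Set.range a) = ⊤ := by
    rw [hind.affineSpan_eq_top_iff_card_eq_finrank_add_one]; simp
  have hx : x ∈ affineSpan ℝ (Set.range a) := by rw [htop]; trivial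
  obtain ⟨w, hw, h⟩ := eq_affineCombination_of_mem_affineSpan_of_fintype hx
  refine ⟨w, hw, ?_⟩
  rw [h, Finset.affineCombination_eq_linear_combination _ _ _ hw, pt]

lemma deg_one (a : Fin 4 → E3) (q : MvPolynomial (Fin 3) ℝ) (hq : q.totalDegree ≤ 1)
    (t : Fin 4 → ℝ) (ht : ∑ i, t i = 1) :
    evalP (pt a t) q = ∑ i, evalP (a i) q * t i := by
  simp only [evalP, MvPolynomial.eval_eq']
  simp only [Finset.sum_mul]
  rw [Finset.sum_comm]
  refine Finset.sum_congr rfl fun d hd => ?_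
  have h1 := (MvPolynomial.le_totalDegree hd).trans hq
  rw [Finsupp.sum_fintype _ _ (by simp)] at h1
  simp only [Fin.sum_univ_three] at h1
  simp only [Fin.prod_univ_three, pt_coord, mul_assoc, ← Finset.mul_sum]
  congr 1
  have hcases : (d 0 = 0 ∧ d 1 = 0 ∧ d 2 = 0) ∨ (d 0 = 1 ∧ d 1 = 0 ∧ d 2 = 0) ∨
    (d 0 = 0 ∧ d 1 = 1 ∧ d 2 = 0) ∨ (d 0 = 0 ∧ d 1 = 0 ∧ d 2 = 1) := by omega
  rcases hcases with ⟨e0, e1, e2⟩ | ⟨e0, e1, e2⟩ | ⟨e0, e1, e2⟩ | ⟨e0, e1, e2⟩ <;>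
    simp [e0, e1, e2, ht]

lemma deg_two (a : Fin 4 → E3) (v : MvPolynomial (Fin 3) ℝ) (hv : v.totalDegree ≤ 2) :
    ∃ c : Fin 4 → Fin 4 → ℝ, ∀ t : Fin 4 → ℝ, ∑ i, t i = 1 →
      evalP (pt a t) v = ∑ i, ∑ j, c i j * (t i * t j) := by
  have key : ∀ d : Fin 3 →₀ ℕ, ∃ l m : Fin 4 → ℝ, d ∈ v.support → ∀ t : Fin 4 → ℝ, ∑ i, t i = 1 →
      ∏ j, (pt a t j) ^ d j = (∑ i, l i * t i) * (∑ i, m i * t i) := by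
    intro d
    by_cases hd : d ∈ v.support
    swap
    · exact ⟨0, 0, fun h => absurd h hd⟩
    have h1 := (MvPolynomial.le_totalDegree hd).trans hv
    rw [Finsupp.sum_fintype _ _ (by simp)] at h1
    simp only [Fin.sum_univ_three] at h1
    simp only [Fin.prod_univ_three, pt_coord]
    have hcases : (d 0 = 0 ∧ d 1 = 0 ∧ d 2 = 0) ∨ (d 0 = 1 ∧ d 1 = 0 ∧ d 2 = 0) ∨
      (d 0 = 0 ∧ d 1 = 1 ∧ d 2 = 0) ∨ (d 0 = 0 ∧ d 1 = 0 ∧ d 2 = 1) ∨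
      (d 0 = 2 ∧ d 1 = 0 ∧ d 2 = 0) ∨ (d 0 = 0 ∧ d 1 = 2 ∧ d 2 = 0) ∨
      (d 0 = 0 ∧ d 1 = 0 ∧ d 2 = 2) ∨ (d 0 = 1 ∧ d 1 = 1 ∧ d 2 = 0) ∨
      (d 0 = 1 ∧ d 1 = 0 ∧ d 2 = 1) ∨ (d 0 = 0 ∧ d 1 = 1 ∧ d 2 = 1) := by omega
    rcases hcases with ⟨e0, e1, e2⟩ | ⟨e0, e1, e2⟩ | ⟨e0, e1, e2⟩ | ⟨e0, e1, e2⟩ | ⟨e0, e1, e2⟩ |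
      ⟨e0, e1, e2⟩ | ⟨e0, e1, e2⟩ | ⟨e0, e1, e2⟩ | ⟨e0, e1, e2⟩ | ⟨e0, e1, e2⟩
    · exact ⟨fun _ => 1, fun _ => 1, fun _ t ht => by simp [e0, e1, e2, ht]⟩
    · exact ⟨fun i => a i 0, fun _ => 1, fun _ t ht => by simp [e0, e1, e2, ht]⟩
    · exact ⟨fun i => a i 1, fun _ => 1, fun _ t ht => by simp [e0, e1, e2, ht]⟩
    · exact ⟨fun i => a i 2, fun _ => 1, fun _ t ht => by simp [e0, e1, e2, ht]⟩
    · exact ⟨fun i => a i 0, fun i => a i 0, fun _ t ht => by simp [e0, e1, e2, sq]⟩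
    · exact ⟨fun i => a i 1, fun i => a i 1, fun _ t ht => by simp [e0, e1, e2, sq]⟩
    · exact ⟨fun i => a i 2, fun i => a i 2, fun _ t ht => by simp [e0, e1, e2, sq]⟩
    · exact ⟨fun i => a i 0, fun i => a i 1, fun _ t ht => by simp [e0, e1, e2]⟩
    · exact ⟨fun i => a i 0, fun i => a i 2, fun _ t ht => by simp [e0, e1, e2]⟩
    · exact ⟨fun i => a i 1, fun i => a i 2, fun _ t ht => by simp [e0, e1, e2]⟩
  choose l m hlm using key
  refine ⟨fun i j => ∑ d ∈ v.support, coeff d v * (l d i * m d j), fun t ht => ?_⟩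
  simp only [evalP, MvPolynomial.eval_eq']
  simp only [Fin.sum_univ_four, Finset.sum_mul, ← Finset.sum_add_distrib]
  refine Finset.sum_congr rfl fun d hd => ?_
  rw [hlm d hd t ht]
  simp only [Fin.sum_univ_four]
  ring

lemma face_eq_s9 (a : Fin 4 → E3) (F : Fin 4) :
    face a F = convexHull ℝ {a (F.succAbove 0), a (F.succAbove 1), a (F.succAbove 2)} := by
  have : a '' {j | j ≠ F} = {a (F.succAbove 0), a (F.succAbove 1), a (F.succAbove 2)} := by
    have h : {j : Fin 4 | j ≠ F} = Set.range F.succAbove := by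
      rw [Fin.range_succAbove]; rfl
    rw [h, ← Set.range_comp]
    ext x
    simp [Fin.exists_fin_succ, eq_comm]
  rw [face, this]

/-- The moment on a facet (up to a scalar) in terms of barycentric coefficients. -/
def mom (c : Fin 4 → Fin 4 → ℝ) (k : Fin 4 → ℝ) (g : Fin 3 → Fin 4) : ℝ :=
  (k (g 0) * (6 * c (g 0) (g 0) + 2 * c (g 1) (g 1) + 2 * c (g 2) (g 2)
          + 2 * (c (g 0) (g 1) + c (g 1) (g 0)) + 2 * (c (g 0) (g 2) + c (g 2) (g 0))
          + (c (g 1) (g 2) + c (g 2) (g 1)))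
        + k (g 1) * (2 * c (g 0) (g 0) + 6 * c (g 1) (g 1) + 2 * c (g 2) (g 2)
          + 2 * (c (g 0) (g 1) + c (g 1) (g 0)) + (c (g 0) (g 2) + c (g 2) (g 0))
          + 2 * (c (g 1) (g 2) + c (g 2) (g 1)))
        + k (g 2) * (2 * c (g 0) (g 0) + 2 * c (g 1) (g 1) + 6 * c (g 2) (g 2)
          + (c (g 0) (g 1) + c (g 1) (g 0)) + 2 * (c (g 0) (g 2) + c (g 2) (g 0))
          + 2 * (c (g 1) (g 2) + c (g 2) (g 1))))

lemma moment (a : Fin 4 → E3) (hind : AffineIndependent ℝ a) (F : Fin 4) :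
    ∃ K : ℝ, K ≠ 0 ∧ ∀ (c : Fin 4 → Fin 4 → ℝ) (k : Fin 4 → ℝ) (v q : MvPolynomial (Fin 3) ℝ),
      (∀ t : Fin 4 → ℝ, ∑ i, t i = 1 → evalP (pt a t) v = ∑ i, ∑ j, c i j * (t i * t j)) →
      (∀ t : Fin 4 → ℝ, ∑ i, t i = 1 → evalP (pt a t) q = ∑ i, k i * t i) →
      ∀ g : Fin 3 → Fin 4, g = F.succAbove →
      ∫ x in face a F, evalP x v * evalP x q ∂(μH[2]) =
      K * mom c k g := by
  have hli : LinearIndependent ℝ ![a (F.succAbove 1) - a (F.succAbove 0),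
      a (F.succAbove 2) - a (F.succAbove 0)] := by
    have h1 := hind.comp_embedding F.succAboveEmb
    rw [affineIndependent_iff_linearIndependent_vsub ℝ _ (0 : Fin 3)] at h1
    have h2 := h1.comp (fun i : Fin 2 => (⟨i.succ, Fin.succ_ne_zero i⟩ : {x : Fin 3 // x ≠ 0}))
      (fun i j h => by simpa using h)
    have h3 : ![a (F.succAbove 1) - a (F.succAbove 0), a (F.succAbove 2) - a (F.succAbove 0)] =
        ((fun i : {x : Fin 3 // x ≠ 0} => (a ∘ F.succAboveEmb) i -ᵥ (a ∘ F.succAboveEmb) 0) ∘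
          fun i : Fin 2 => (⟨i.succ, Fin.succ_ne_zero i⟩ : {x : Fin 3 // x ≠ 0})) := by
      funext i
      fin_cases i <;> simp
    rw [h3]
    exact h2
  obtain ⟨K, hK, hint⟩ := face_int _ _ _ hli
  refine ⟨K / 120, by positivity, ?_⟩
  rintro c k v q hv hq g rfl
  rw [mom, face_eq_s9, hint, div_mul_eq_mul_div, mul_div_assoc, ← tri_int]
  congr 2
  ext p
  have hphi : phi (a (F.succAbove 0)) (a (F.succAbove 1)) (a (F.succAbove 2)) p
      = pt a (F.insertNth (α := fun _ => ℝ) 0 ![1 - p.1 - p.2, p.1, p.2]) := by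
    simp [phi, pt, Fin.sum_univ_succAbove _ F, Fin.sum_univ_three]
  have hsum : ∑ i, (F.insertNth (α := fun _ => ℝ) 0 ![1 - p.1 - p.2, p.1, p.2] : Fin 4 → ℝ) i = 1 := by
    simp [Fin.sum_univ_succAbove _ F, Fin.sum_univ_three]
    ring
  rw [hphi, hv _ hsum, hq _ hsum]
  simp only [Fin.sum_univ_succAbove _ F, Fin.insertNth_apply_same, Fin.insertNth_apply_succAbove,
    Fin.sum_univ_three, Matrix.cons_val]
  ring

/-- `𝔟₂ = 2 − 4∑λᵢ²` has vanishing first-order facet moments, and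
the space of such `P₂` bubbles is exactly the multiples of `𝔟₂`. -/
theorem stmt9 (a : Fin 4 → E3) (hind : AffineIndependent ℝ a)
    (lam : Fin 4 → MvPolynomial (Fin 3) ℝ)
    (hdeg : ∀ i, (lam i).totalDegree ≤ 1)
    (hval : ∀ i j, evalP (a j) (lam i) = if i = j then 1 else 0) :
    (∀ (F : Fin 4) (q : MvPolynomial (Fin 3) ℝ), q.totalDegree ≤ 1 →
      ∫ x in face a F, evalP x (2 - 4 * ∑ i, lam i ^ 2) * evalP x q ∂(μH[2]) = 0) ∧
    {v : MvPolynomial (Fin 3) ℝ | v.totalDegree ≤ 2 ∧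
        ∀ (F : Fin 4) (q : MvPolynomial (Fin 3) ℝ), q.totalDegree ≤ 1 →
          ∫ x in face a F, evalP x v * evalP x q ∂(μH[2]) = 0}
      = {v : MvPolynomial (Fin 3) ℝ | ∃ c : ℝ, v = c • (2 - 4 * ∑ i, lam i ^ 2)} := by
  have hlam : ∀ i (t : Fin 4 → ℝ), ∑ i, t i = 1 → evalP (pt a t) (lam i) = t i := by
    intro i t ht
    rw [deg_one a _ (hdeg i) t ht]
    simp [hval]
  have hb : ∀ t : Fin 4 → ℝ, ∑ i, t i = 1 → evalP (pt a t) (2 - 4 * ∑ i, lam i ^ 2)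
      = ∑ i, ∑ j, (if i = j then (-2 : ℝ) else 2) * (t i * t j) := by
    intro t ht
    have h1 : evalP (pt a t) (2 - 4 * ∑ i, lam i ^ 2) = 2 - 4 * ∑ i, t i ^ 2 := by
      simp only [← hlam _ t ht]
      simp [evalP]
    have h2 : 2 - 4 * ∑ i, t i ^ 2 = 2 * (∑ i, t i) ^ 2 - 4 * ∑ i, t i ^ 2 := by
      rw [ht]; norm_num
    rw [h1, h2]
    simp [Fin.sum_univ_four]
    ring
  have hfirst : ∀ (F : Fin 4) (q : MvPolynomial (Fin 3) ℝ), q.totalDegree ≤ 1 →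
      ∫ x in face a F, evalP x (2 - 4 * ∑ i, lam i ^ 2) * evalP x q ∂(μH[2]) = 0 := by
    intro F q hq
    obtain ⟨K, hK, h⟩ := moment a hind F
    rw [h _ _ _ q hb (fun t ht => deg_one a q hq t ht) _ rfl]
    simp [mom, (Fin.succAbove_right_injective (p := F)).eq_iff]
    right
    ring
  refine ⟨hfirst, ?_⟩
  ext v
  simp only [Set.mem_ofPred_eq]
  constructor
  · rintro ⟨hv, hvF⟩
    obtain ⟨c, hc⟩ := deg_two a v hv
    have key : ∀ F m : Fin 4, mom c (fun i => if m = i then 1 else 0) F.succAbove = 0 := fun F m => by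
      have h0 := hvF F (lam m) (hdeg m)
      obtain ⟨K, hK, h⟩ := moment a hind F
      rw [h c (fun i => if m = i then 1 else 0) v (lam m) hc
        (fun t ht => by rw [hlam m t ht]; simp) _ rfl] at h0
      exact (mul_eq_zero.mp h0).resolve_left hK
    have e01 := key 0 1
    have e02 := key 0 2
    have e03 := key 0 3
    have e10 := key 1 0
    have e12 := key 1 2
    have e13 := key 1 3
    have e20 := key 2 0
    have e21 := key 2 1
    have e23 := key 2 3
    have e30 := key 3 0
    have e31 := key 3 1
    have e32 := key 3 2
    simp [mom, Fin.succAbove, Fin.lt_def] at e01 e02 e03 e10 e12 e13 e20 e21 e23 e30 e31 e32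
    refine ⟨-c 0 0 / 2, MvPolynomial.funext fun x => ?_⟩
    obtain ⟨t, ht, hx⟩ := pt_surj a hind (WithLp.toLp 2 x)
    have h1 := hc t ht
    have h2 := hb t ht
    rw [← hx] at h1 h2
    have h3 : eval x v = evalP (WithLp.toLp 2 x) v := rfl
    have h4 : eval x (2 - 4 * ∑ i, lam i ^ 2) = evalP (WithLp.toLp 2 x) (2 - 4 * ∑ i, lam i ^ 2) := rfl
    rw [smul_eval, h3, h4, h1, h2]
    have d1 : c 1 1 = c 0 0 := by linarith
    have d2 : c 2 2 = c 0 0 := by linarith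
    have d3 : c 3 3 = c 0 0 := by linarith
    have f01 : c 1 0 = -2 * c 0 0 - c 0 1 := by linarith
    have f02 : c 2 0 = -2 * c 0 0 - c 0 2 := by linarith
    have f03 : c 3 0 = -2 * c 0 0 - c 0 3 := by linarith
    have f12 : c 2 1 = -2 * c 0 0 - c 1 2 := by linarith
    have f13 : c 3 1 = -2 * c 0 0 - c 1 3 := by linarith
    have f23 : c 3 2 = -2 * c 0 0 - c 2 3 := by linarith
    simp [Fin.sum_univ_four, d1, d2, d3, f01, f02, f03, f12, f13, f23]
    ring
  · rintro ⟨c, rfl⟩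
    refine ⟨?_, fun F q hq => ?_⟩
    · refine (totalDegree_smul_le _ _).trans ((totalDegree_sub _ _).trans (max_le ?_ ?_))
      · have : (2 : MvPolynomial (Fin 3) ℝ) = C 2 := (map_ofNat C 2).symm
        rw [this, totalDegree_C]; norm_num
      · have : (4 : MvPolynomial (Fin 3) ℝ) = C 4 := (map_ofNat C 4).symm
        rw [this, ← smul_eq_C_mul]
        refine (totalDegree_smul_le _ _).trans (totalDegree_finsetSum_le fun i _ => ?_)
        refine (totalDegree_pow _ _).trans ?_
        have := hdeg i
        omega
    · have h := hfirst F q hq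
      have : ∀ x, evalP x (c • (2 - 4 * ∑ i, lam i ^ 2)) * evalP x q
          = c * (evalP x (2 - 4 * ∑ i, lam i ^ 2) * evalP x q) := by
        intro x
        simp only [evalP, smul_eval]
        ring
      simp only [this]
      rw [integral_const_mul, h, mul_zero]
end
end
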